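/- Let ω be continuous on [0,1]. The function ℛ(θ) = θ²/2 + d(θ) − Ω(1) is differentiable on (θ₀, ∞) with derivative ℛ′(θ) = θ·(1 − ∫₀¹ (θ² − 2Ω(τ))^{−3/2} dτ). In particular, ℛ′(θ) > 0 exactly when the Froude number of the corresponding uniform stream solution exceeds 1, i.e. when ∫₀¹ (θ² − 2Ω(τ))^{−3/2} dτ < 1. -/

import Mathlib

/-- `Omg ω τ = ∫₀^τ ω(s) ds`. -/
noncomputable def Omg (ω : ℝ → ℝ) (τ : ℝ) : ℝ := ∫ s in (0:ℝ)..τ, ω s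

/-- `theta0 ω = √(2 · max_{τ∈[0,1]} Ω(τ))`. -/
noncomputable def theta0 (ω : ℝ → ℝ) : ℝ := Real.sqrt (2 * sSup (Omg ω '' Set.Icc 0 1))

/-- `dfun ω θ = ∫₀¹ (θ² − 2Ω(τ))^{−1/2} dτ`. -/
noncomputable def dfun (ω : ℝ → ℝ) (θ : ℝ) : ℝ :=
  ∫ τ in (0:ℝ)..1, 1 / Real.sqrt (θ ^ 2 - 2 * Omg ω τ)

/-- `Rcal ω θ = θ²/2 + d(θ) − Ω(1)`. -/
noncomputable def Rcal (ω : ℝ → ℝ) (θ : ℝ) : ℝ := θ ^ 2 / 2 + dfun ω θ - Omg ω 1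

theorem continuousOn_Omg {ω : ℝ → ℝ} (hω : ContinuousOn ω (Set.Icc 0 1)) :
    ContinuousOn (Omg ω) (Set.Icc 0 1) := by
  have h := intervalIntegral.continuousOn_primitive_interval (a := 0) (b := 1) (f := ω)
    (μ := MeasureTheory.volume)
    (by rw [Set.uIcc_of_le zero_le_one]; exact hω.integrableOn_Icc)
  rwa [Set.uIcc_of_le zero_le_one] at h

theorem theta0_nonneg (ω : ℝ → ℝ) : 0 ≤ theta0 ω := Real.sqrt_nonneg _

theorem two_mul_Omg_le_theta0_sq {ω : ℝ → ℝ} (hω : ContinuousOn ω (Set.Icc 0 1)) {τ : ℝ}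
    (hτ : τ ∈ Set.Icc (0 : ℝ) 1) : 2 * Omg ω τ ≤ theta0 ω ^ 2 := by
  have hbdd : BddAbove (Omg ω '' Set.Icc 0 1) :=
    (isCompact_Icc.image_of_continuousOn (continuousOn_Omg hω)).bddAbove
  have hle : ∀ t ∈ Set.Icc (0 : ℝ) 1, Omg ω t ≤ sSup (Omg ω '' Set.Icc 0 1) :=
    fun t ht => le_csSup hbdd ⟨t, ht, rfl⟩
  have h0 : Omg ω 0 = 0 := by simp [Omg]
  have hM := hle 0 (by simp)
  rw [theta0, Real.sq_sqrt (by linarith)]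
  linarith [hle τ hτ]

theorem continuousOn_one_div_sqrt {ω : ℝ → ℝ} (hω : ContinuousOn ω (Set.Icc 0 1)) {θ : ℝ}
    (hθ : theta0 ω < θ) :
    ContinuousOn (fun τ => 1 / Real.sqrt (θ ^ 2 - 2 * Omg ω τ)) (Set.Icc 0 1) := by
  refine continuousOn_const.div
    (continuousOn_const.sub (continuousOn_const.mul (continuousOn_Omg hω))).sqrt fun τ hτ => ?_
  refine (Real.sqrt_pos.2 ?_).ne'
  nlinarith [two_mul_Omg_le_theta0_sq hω hτ, theta0_nonneg ω]

theorem hasDerivAt_one_div_sqrt_sq_sub {c x : ℝ} (h : 0 < x ^ 2 - c) :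
    HasDerivAt (fun y => 1 / Real.sqrt (y ^ 2 - c)) (-(x * (1 / Real.sqrt (x ^ 2 - c) ^ 3))) x := by
  have hs := Real.sqrt_pos.2 h
  have h1 := (((hasDerivAt_pow 2 x).sub_const c).sqrt h.ne').inv hs.ne'
  simp only [one_div]
  refine HasDerivAt.congr_deriv h1 ?_
  field_simp
  simp

theorem hasDerivAt_dfun {ω : ℝ → ℝ} (hω : ContinuousOn ω (Set.Icc 0 1)) {θ : ℝ}
    (hθ : theta0 ω < θ) :
    HasDerivAt (dfun ω)
      (-(θ * ∫ τ in (0:ℝ)..1, 1 / (Real.sqrt (θ ^ 2 - 2 * Omg ω τ)) ^ 3)) θ := by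
  obtain ⟨a, ha, haθ⟩ := exists_between hθ
  have h0 := theta0_nonneg ω
  have hδ : 0 < a ^ 2 - theta0 ω ^ 2 := by nlinarith
  have hsub : Set.uIoc (0 : ℝ) 1 ⊆ Set.Icc 0 1 := by
    rw [Set.uIoc_of_le zero_le_one]; exact Set.Ioc_subset_Icc_self
  have hlow : ∀ t ∈ Set.uIoc (0 : ℝ) 1, ∀ x ∈ Set.Ioo a (θ + 1),
      a ^ 2 - theta0 ω ^ 2 ≤ x ^ 2 - 2 * Omg ω t := fun t ht x hx => by
    nlinarith [two_mul_Omg_le_theta0_sq hω (hsub ht), hx.1]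
  have hmem : Set.Ioo a (θ + 1) ∈ nhds θ := Ioo_mem_nhds haθ (lt_add_one θ)
  have hmeas {f : ℝ → ℝ} (hf : ContinuousOn f (Set.Icc 0 1)) :
      MeasureTheory.AEStronglyMeasurable f
        (MeasureTheory.volume.restrict (Set.uIoc (0 : ℝ) 1)) :=
    (hf.mono hsub).aestronglyMeasurable measurableSet_uIoc
  have hcont := continuousOn_one_div_sqrt hω hθ
  have key := (intervalIntegral.hasDerivAt_integral_of_dominated_loc_of_deriv_le
    (μ := MeasureTheory.volume) (a := 0) (b := 1)
    (F := fun x τ => 1 / Real.sqrt (x ^ 2 - 2 * Omg ω τ))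
    (F' := fun x τ => -(x * (1 / Real.sqrt (x ^ 2 - 2 * Omg ω τ) ^ 3)))
    (bound := fun _ => (θ + 1) * (1 / Real.sqrt (a ^ 2 - theta0 ω ^ 2) ^ 3))
    hmem ?_ ?_ ?_ ?_ ?_ ?_).2
  · rw [intervalIntegral.integral_neg, intervalIntegral.integral_const_mul] at key
    exact key
  · filter_upwards [hmem] with x hx
    exact hmeas (continuousOn_one_div_sqrt hω (ha.trans hx.1))
  · exact ContinuousOn.intervalIntegrable (by rwa [Set.uIcc_of_le zero_le_one])
  · refine hmeas ?_
    have h3 := (continuousOn_const (c := θ)).mul (hcont.pow 3)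
    refine h3.neg.congr fun τ _ => ?_
    simp
  · refine .of_forall fun t ht x hx => ?_
    have hx0 : 0 ≤ x := by linarith [hx.1]
    have hs := Real.sqrt_pos.2 hδ
    rw [norm_neg, Real.norm_of_nonneg (by positivity)]
    have := hlow t ht x hx
    have := hx.2.le
    have : 0 ≤ θ + 1 := hx0.trans this
    gcongr
  · exact intervalIntegrable_const
  · exact .of_forall fun t ht x hx =>
      hasDerivAt_one_div_sqrt_sq_sub (hδ.trans_le (hlow t ht x hx))

/-- `ℛ` is differentiable on `(θ₀,∞)` with
`ℛ′(θ) = θ·(1 − ∫₀¹ (θ²−2Ω(τ))^{−3/2} dτ)`; in particular `ℛ′(θ) > 0` exactly when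
`∫₀¹ (θ²−2Ω(τ))^{−3/2} dτ < 1` (Froude number exceeds 1). -/
theorem stmt5 (ω : ℝ → ℝ) (hω : ContinuousOn ω (Set.Icc 0 1)) :
    ∀ θ ∈ Set.Ioi (theta0 ω),
      HasDerivAt (Rcal ω)
        (θ * (1 - ∫ τ in (0:ℝ)..1, 1 / (Real.sqrt (θ ^ 2 - 2 * Omg ω τ)) ^ 3)) θ ∧
      (0 < θ * (1 - ∫ τ in (0:ℝ)..1, 1 / (Real.sqrt (θ ^ 2 - 2 * Omg ω τ)) ^ 3) ↔
        (∫ τ in (0:ℝ)..1, 1 / (Real.sqrt (θ ^ 2 - 2 * Omg ω τ)) ^ 3) < 1) := by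
  intro θ hθ
  refine ⟨?_, ?_⟩
  · refine ((((hasDerivAt_pow 2 θ).div_const 2).add (hasDerivAt_dfun hω hθ)).sub_const
      (Omg ω 1)).congr_deriv ?_
    push_cast
    ring
  · rw [mul_pos_iff_of_pos_left ((theta0_nonneg ω).trans_lt hθ), sub_pos]
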